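/- arXiv:2107.02370 — 4 statements merged into one kernel-verified Lean document; each statement's English description precedes it below -/
import Mathlib

section
/- For every $n \ge 1$ and $t \ge 3$, every $(2t-1)$-partite graph $G$ with parts of size $n$ and maximum degree $\Delta(G) < n$ contains a crossing independent set of size $t+1$ (an independent set meeting each part in at most one vertex). -/
open scoped Classical

/-- `G` is an `r`-partite graph on `Fin r × Fin n` with parts the fibers of `Prod.fst`. -/
def IsPartite {r n : ℕ} (G : SimpleGraph (Fin r × Fin n)) : Prop :=
  ∀ v w, G.Adj v w → v.1 ≠ w.1

/-- Crossing independent sets. -/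
def CrossInd {r n : ℕ} (G : SimpleGraph (Fin r × Fin n)) (s : Finset (Fin r × Fin n)) : Prop :=
  ∀ v ∈ s, ∀ w ∈ s, v ≠ w → ¬G.Adj v w ∧ v.1 ≠ w.1

theorem CrossInd.insert_of {r n : ℕ} {G : SimpleGraph (Fin r × Fin n)}
    {s : Finset (Fin r × Fin n)} (hs : CrossInd G s) (v : Fin r × Fin n)
    (h1 : ∀ u ∈ s, ¬ G.Adj u v) (h2 : ∀ u ∈ s, u.1 ≠ v.1) : CrossInd G (insert v s) := by
  intro a ha b hb hab
  rw [Finset.mem_insert] at ha hb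
  rcases ha with rfl | ha <;> rcases hb with rfl | hb
  · exact absurd rfl hab
  · exact ⟨fun h => h1 b hb h.symm, (h2 b hb).symm⟩
  · exact ⟨h1 a ha, h2 a ha⟩
  · exact hs a ha b hb hab

theorem CrossInd.mono {r n : ℕ} {G : SimpleGraph (Fin r × Fin n)}
    {s u : Finset (Fin r × Fin n)} (hs : CrossInd G s) (h : u ⊆ s) : CrossInd G u :=
  fun a ha b hb => hs a (h ha) b (h hb)

/-- The vertices in parts not met by `s`. -/
noncomputable def outside {r n : ℕ} (s : Finset (Fin r × Fin n)) : Finset (Fin r × Fin n) :=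
  (Finset.univ \ s.image Prod.fst) ×ˢ Finset.univ

theorem mem_outside {r n : ℕ} (s : Finset (Fin r × Fin n)) (v : Fin r × Fin n) :
    v ∈ outside s ↔ ∀ u ∈ s, u.1 ≠ v.1 := by
  rw [outside, Finset.mem_product, Finset.mem_sdiff, Finset.mem_image]
  simp only [Finset.mem_univ, true_and, and_true]
  push Not
  rfl

theorem CrossInd.card_outside {r n : ℕ} {G : SimpleGraph (Fin r × Fin n)}
    {s : Finset (Fin r × Fin n)} (hs : CrossInd G s) :
    (outside s).card = (r - s.card) * n := by
  rw [outside, Finset.card_product, Finset.card_sdiff_of_subset (Finset.subset_univ _),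
    Finset.card_image_of_injOn]
  · simp
  · intro a ha b hb hab
    by_contra hne
    exact (hs a ha b hb hne).2 hab

/-- The neighbourhood of a set. -/
noncomputable def nbd {r n : ℕ} (G : SimpleGraph (Fin r × Fin n))
    (s : Finset (Fin r × Fin n)) : Finset (Fin r × Fin n) :=
  s.biUnion fun u => G.neighborFinset u

theorem mem_nbd {r n : ℕ} (G : SimpleGraph (Fin r × Fin n))
    (s : Finset (Fin r × Fin n)) (v : Fin r × Fin n) :
    v ∈ nbd G s ↔ ∃ u ∈ s, G.Adj u v := by
  simp [nbd]

theorem card_nbd {r n : ℕ} (G : SimpleGraph (Fin r × Fin n)) (hΔ : G.maxDegree < n)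
    (s : Finset (Fin r × Fin n)) : (nbd G s).card ≤ s.card * (n - 1) := by
  refine Finset.card_biUnion_le_card_mul _ _ _ fun u _ => ?_
  rw [G.card_neighborFinset_eq_degree]
  have := G.degree_le_maxDegree u
  omega

/-- Every `(2t-1)`-partite graph with parts of size `n` and maximum degree less than `n`
contains a crossing independent set of size `t+1`. -/
theorem stmt4 (n t : ℕ) (hn : 1 ≤ n) (ht : 3 ≤ t)
    (G : SimpleGraph (Fin (2 * t - 1) × Fin n)) (hp : IsPartite G)
    (hΔ : G.maxDegree < n) :
    ∃ s : Finset (Fin (2 * t - 1) × Fin n), s.card = t + 1 ∧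
      ∀ v ∈ s, ∀ w ∈ s, v ≠ w → ¬G.Adj v w ∧ v.1 ≠ w.1 := by
  by_contra hcon
  have hno : ∀ s, CrossInd G s → s.card ≤ t := by
    intro s hs
    by_contra hlt
    obtain ⟨u, hu, hc⟩ := Finset.exists_subset_card_eq (show t + 1 ≤ s.card by omega)
    exact hcon ⟨u, hc, hs.mono hu⟩
  have hsat : ∀ s, CrossInd G s → s.card = t → outside s ⊆ nbd G s := by
    intro s hs hc v hv
    rw [mem_outside] at hv
    by_contra hd
    rw [mem_nbd] at hd
    push Not at hd
    have h1 := hno _ (hs.insert_of v hd hv)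
    rw [Finset.card_insert_of_notMem (fun h => hv v h rfl)] at h1
    omega
  -- a maximal pair
  let D : (Fin (2 * t - 1) × Fin n) → Fin (2 * t - 1) → Finset (Fin (2 * t - 1) × Fin n) :=
    fun v i => (G.neighborFinset v).filter fun w => w.1 = i
  obtain ⟨⟨x, a⟩, hxa, hmax⟩ := Finset.exists_max_image
    (Finset.univ.filter fun q : (Fin (2 * t - 1) × Fin n) × Fin (2 * t - 1) => q.1.1 ≠ q.2)
    (fun q => (D q.1 q.2).card)
    ⟨((⟨0, by omega⟩, ⟨0, by omega⟩), ⟨1, by omega⟩), by simp⟩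
  simp only [Finset.mem_filter, Finset.mem_univ, true_and] at hxa hmax
  have hpart : ∀ i : Fin (2 * t - 1),
      (({i} : Finset (Fin (2 * t - 1))) ×ˢ (Finset.univ : Finset (Fin n))).card = n := by
    intro i; simp
  have hxdeg : (D x a).card < n := by
    have h1 : (D x a).card ≤ (G.neighborFinset x).card := Finset.card_filter_le _ _
    rw [G.card_neighborFinset_eq_degree] at h1
    have := G.degree_le_maxDegree x
    omega
  obtain ⟨y, hy, hyx⟩ := Finset.exists_mem_notMem_of_card_lt_card
    (hxdeg.trans_eq (hpart a).symm)
  have hya : y.1 = a := by simpa using (Finset.mem_product.1 hy).1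
  have hxy : ¬ G.Adj x y := fun h => hyx (by simp [D, h, hya])
  have hC0 : CrossInd G {y, x} := by
    refine CrossInd.insert_of ?_ y ?_ ?_
    · intro p hp q hq hpq
      rw [Finset.mem_singleton] at hp hq
      exact absurd (hp.trans hq.symm) hpq
    · intro u hu; rw [Finset.mem_singleton] at hu; rw [hu]; exact hxy
    · intro u hu; rw [Finset.mem_singleton] at hu; rw [hu, hya]; exact hxa
  obtain ⟨T, hT, hTmax⟩ := Finset.exists_max_image
    (Finset.univ.filter fun s : Finset (Fin (2 * t - 1) × Fin n) => CrossInd G s ∧ {y, x} ⊆ s)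
    Finset.card ⟨{y, x}, by simp [hC0]⟩
  simp only [Finset.mem_filter, Finset.mem_univ, true_and] at hT hTmax
  obtain ⟨hTC, hTyx⟩ := hT
  have hyT : y ∈ T := hTyx (by simp)
  have hxT : x ∈ T := hTyx (by simp)
  have hTdom : outside T ⊆ nbd G T := by
    intro v hv
    rw [mem_outside] at hv
    by_contra hd
    rw [mem_nbd] at hd
    push Not at hd
    have h1 := hTmax _ ⟨hTC.insert_of v hd hv, hTyx.trans (Finset.subset_insert _ _)⟩
    rw [Finset.card_insert_of_notMem (fun h => hv v h rfl)] at h1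
    omega
  obtain ⟨m, rfl⟩ : ∃ m, n = m + 1 := ⟨n - 1, by omega⟩
  have hTt : T.card = t := by
    refine le_antisymm (hno T hTC) ?_
    by_contra hlt
    have h1 := (Finset.card_le_card hTdom).trans (card_nbd G hΔ T)
    rw [hTC.card_outside] at h1
    have h2 : T.card ≤ 2 * t - 1 - T.card := by omega
    have h3 := Nat.mul_le_mul_right (m + 1) h2
    have h4 : 0 < T.card := Finset.card_pos.2 ⟨x, hxT⟩
    rw [Nat.add_sub_cancel] at h1
    nlinarith
  have hout : (outside T).card = (t - 1) * (m + 1) := by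
    rw [hTC.card_outside, hTt]; congr 1; omega
  -- a vertex dominated only by x
  have hlt : (nbd G (T.erase x)).card < (outside T).card := by
    have h1 := card_nbd G hΔ (T.erase x)
    rw [Finset.card_erase_of_mem hxT, hTt, Nat.add_sub_cancel] at h1
    rw [hout, Nat.mul_succ]
    omega
  obtain ⟨z, hz, hzn⟩ := Finset.exists_mem_notMem_of_card_lt_card hlt
  rw [mem_outside] at hz
  rw [mem_nbd] at hzn
  push Not at hzn
  have hT3 : CrossInd G (insert z (T.erase x)) :=
    (hTC.mono (Finset.erase_subset _ _)).insert_of z hzn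
      fun u hu => hz u (Finset.mem_of_mem_erase hu)
  have hT3c : (insert z (T.erase x)).card = t := by
    rw [Finset.card_insert_of_notMem
      (fun h => hz z (Finset.mem_of_mem_erase h) rfl), Finset.card_erase_of_mem hxT]
    omega
  have hdom3 := hsat _ hT3 hT3c
  have hB : ({x.1} : Finset (Fin (2 * t - 1))) ×ˢ (Finset.univ : Finset (Fin (m + 1))) ⊆
      D z x.1 ∪ (nbd G T).filter (fun w => w.1 = x.1) := by
    intro b hb
    have hb1 : b.1 = x.1 := by simpa using (Finset.mem_product.1 hb).1
    have hbo : b ∈ outside (insert z (T.erase x)) := by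
      rw [mem_outside]
      intro u hu
      rw [hb1]
      rcases Finset.mem_insert.1 hu with rfl | hu
      · exact (hz x hxT).symm
      · exact (hTC u (Finset.mem_of_mem_erase hu) x hxT (Finset.ne_of_mem_erase hu)).2
    obtain ⟨u, hu, hub⟩ := (mem_nbd _ _ _).1 (hdom3 hbo)
    rw [Finset.mem_union]
    rcases Finset.mem_insert.1 hu with rfl | hu
    · left; simp [D, hub, hb1]
    · right
      rw [Finset.mem_filter, mem_nbd]
      exact ⟨⟨u, Finset.mem_of_mem_erase hu, hub⟩, hb1⟩
  have hBc := (Finset.card_le_card hB).trans (Finset.card_union_le _ _)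
  rw [hpart] at hBc
  have hzd : (D z x.1).card ≤ (D x a).card := hmax (z, x.1) (hz x hxT).symm
  set W := (nbd G T).filter (fun w => w.1 = x.1) with hW
  have hsub : (outside T ∪ W) ∪ D x a ⊆ nbd G T := by
    refine Finset.union_subset (Finset.union_subset hTdom (Finset.filter_subset _ _)) ?_
    intro w hw
    rw [mem_nbd]
    exact ⟨x, hxT, by simpa using (Finset.mem_filter.1 hw).1⟩
  have hd1 : Disjoint (outside T) W := by
    rw [Finset.disjoint_left]
    intro w hw hw'
    exact (mem_outside _ _).1 hw x hxT (Finset.mem_filter.1 hw').2.symm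
  have hd2 : Disjoint (outside T ∪ W) (D x a) := by
    rw [Finset.disjoint_left]
    intro w hw hw'
    have hwa : w.1 = a := (Finset.mem_filter.1 hw').2
    rcases Finset.mem_union.1 hw with hw | hw
    · exact (mem_outside _ _).1 hw y hyT (hya.trans hwa.symm)
    · exact hxa ((Finset.mem_filter.1 hw).2.symm.trans hwa)
  have hfin := (Finset.card_le_card hsub).trans (card_nbd G hΔ T)
  rw [Finset.card_union_of_disjoint hd2, Finset.card_union_of_disjoint hd1, hout, hTt,
    Nat.add_sub_cancel] at hfin
  obtain ⟨k, rfl⟩ : ∃ k, t = k + 1 := ⟨t - 1, by omega⟩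
  rw [Nat.add_sub_cancel] at hfin
  nlinarith
end

section
/- For every $n \ge 1$ and $t \ge 3$, $f(n, 2t-1, t+1) = (2t-3)n$, i.e., the largest minimum degree of a $(2t-1)$-partite $K_{t+1}$-free graph with parts of size $n$ equals $(2t-3)n$. -/
open scoped Classical

/-- `f n r c` : the largest minimum degree among `r`-partite graphs with parts of
size `n` containing no copy of `K_c`. -/
noncomputable def f (n r c : ℕ) : ℕ :=
  sSup {d | ∃ G : SimpleGraph (Fin r × Fin n),
    IsPartite G ∧ G.CliqueFree c ∧ G.minDegree = d}

/-- Greedy extension of a clique inside a large common neighbourhood. -/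
lemma greedy_ext {V : Type*} [Fintype V] [DecidableEq V] (G : SimpleGraph V) (m a : ℕ) (ha : 1 ≤ a)
    (hm : ∀ v, (G.neighborFinset v)ᶜ.card ≤ m) (k : ℕ) :
    ∀ (s : ℕ) (S M : Finset V), G.IsNClique s S → (∀ x ∈ M, ∀ y ∈ S, G.Adj x y) →
      a + k * m ≤ M.card →
      ∃ S' M' : Finset V, G.IsNClique (s + k) S' ∧ (∀ x ∈ M', ∀ y ∈ S', G.Adj x y) ∧
        a ≤ M'.card := by
  induction k with
  | zero => intro s S M hS hM hc; exact ⟨S, M, hS, hM, by simpa using hc⟩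
  | succ k ih =>
    intro s S M hS hM hc
    have hpos : 0 < M.card := by omega
    obtain ⟨v, hv⟩ := Finset.card_pos.mp hpos
    have h1 : G.IsNClique (s + 1) (insert v S) := hS.insert (fun b hb => hM v hv b hb)
    have hc2 : a + k * m ≤ (M ∩ G.neighborFinset v).card := by
      have h2 : (M \ G.neighborFinset v).card ≤ m := by
        refine le_trans (Finset.card_le_card ?_) (hm v)
        intro x hx
        simp only [Finset.mem_sdiff] at hx
        simpa using hx.2
      have h3 := Finset.card_inter_add_card_sdiff M (G.neighborFinset v)
      rw [Nat.succ_mul] at hc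
      omega
    obtain ⟨S', M', h4, h5, h6⟩ := ih (s + 1) (insert v S) (M ∩ G.neighborFinset v) h1 (by
      intro x hx y hy
      rw [Finset.mem_inter, SimpleGraph.mem_neighborFinset] at hx
      rcases Finset.mem_insert.mp hy with rfl | hy
      · exact hx.2.symm
      · exact hM x hx.1 y hy) hc2
    exact ⟨S', M', by rwa [show s + (k + 1) = s + 1 + k by ring], h5, h6⟩

/-- The part of index `p`. -/
noncomputable def part (r n : ℕ) (p : Fin r) : Finset (Fin r × Fin n) :=
  Finset.univ.filter (fun v => v.1 = p)

lemma mem_part {r n : ℕ} (p : Fin r) (v : Fin r × Fin n) : v ∈ part r n p ↔ v.1 = p := by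
  simp [part]

lemma card_part (r n : ℕ) (p : Fin r) : (part r n p).card = n := by
  have : part r n p = ({p} : Finset (Fin r)) ×ˢ (Finset.univ : Finset (Fin n)) := by
    ext v; rw [mem_part, Finset.mem_product]; simp
  rw [this, Finset.card_product]; simp

lemma upper (n s r : ℕ) (hn : 1 ≤ n) (hr : r = 2 * s + 5)
    (G : SimpleGraph (Fin r × Fin n)) (hP : IsPartite G) (hK : G.CliqueFree (s + 4)) :
    G.minDegree ≤ (2 * s + 3) * n := by
  by_contra hlt
  push Not at hlt
  have hV : Fintype.card (Fin r × Fin n) = r * n := by simp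
  have hrn : r * n = (2 * s + 3) * n + 2 * n := by rw [hr]; ring
  -- every vertex has few non-neighbours
  have hm : ∀ v, (G.neighborFinset v)ᶜ.card ≤ 2 * n - 1 := by
    intro v
    have h1 := G.minDegree_le_degree v
    have h2 := Finset.card_add_card_compl (G.neighborFinset v)
    rw [SimpleGraph.card_neighborFinset_eq_degree, hV] at h2
    omega
  have hown : ∀ v, part r n v.1 ⊆ (G.neighborFinset v)ᶜ := by
    intro v x hx
    rw [mem_part] at hx
    simp only [Finset.mem_compl, SimpleGraph.mem_neighborFinset]
    intro h
    exact hP v x h hx.symm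
  -- non-neighbours in other parts
  have hout : ∀ v (A : Finset (Fin r × Fin n)), (∀ x ∈ A, ¬ G.Adj v x ∧ x.1 ≠ v.1) →
      A.card ≤ n - 1 := by
    intro v A hA
    have hd : Disjoint A (part r n v.1) := by
      rw [Finset.disjoint_left]
      intro x hx hx2
      exact (hA x hx).2 ((mem_part _ _).mp hx2)
    have h1 : (A ∪ part r n v.1).card ≤ 2 * n - 1 := by
      refine le_trans (Finset.card_le_card ?_) (hm v)
      refine Finset.union_subset ?_ (hown v)
      intro x hx
      simpa using (hA x hx).1
    rw [Finset.card_union_of_disjoint hd, card_part] at h1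
    omega
  -- choose the minimal pair
  let D : (Fin r × Fin n) × Fin r → ℕ :=
    fun a => (G.neighborFinset a.1 ∩ part r n a.2).card
  obtain ⟨⟨c, q⟩, hcq, hmin⟩ := Finset.exists_min_image
    (Finset.univ.filter (fun a : (Fin r × Fin n) × Fin r => a.2 ≠ a.1.1)) D (by
      refine ⟨((⟨0, by omega⟩, ⟨0, by omega⟩), ⟨1, by omega⟩), ?_⟩
      simp)
  simp only [Finset.mem_filter, Finset.mem_univ, true_and, ne_eq] at hcq hmin
  set d := D (c, q) with hd
  have hdn : (part r n q \ G.neighborFinset c).card + d = n := by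
    have := Finset.card_inter_add_card_sdiff (part r n q) (G.neighborFinset c)
    rw [card_part, Finset.inter_comm] at this
    simp only [hd, D]
    omega
  have hd1 : 1 ≤ d := by
    have : (part r n q \ G.neighborFinset c).card ≤ n - 1 := by
      apply hout c
      intro x hx
      rw [Finset.mem_sdiff, mem_part, SimpleGraph.mem_neighborFinset] at hx
      exact ⟨hx.2, by rw [hx.1]; exact hcq⟩
    omega
  obtain ⟨y, hy⟩ : (G.neighborFinset c ∩ part r n q).Nonempty := Finset.card_pos.mp hd1
  rw [Finset.mem_inter, SimpleGraph.mem_neighborFinset, mem_part] at hy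
  obtain ⟨hcy, hyq⟩ := hy
  -- common neighbourhood
  have hM : (2 * n - d + s + 2) + s * (2 * n - 1) ≤
      (G.neighborFinset c ∩ G.neighborFinset y).card := by
    have h1 := Finset.card_union_add_card_inter (G.neighborFinset c)ᶜ (G.neighborFinset y)ᶜ
    have h2 : (part r n q \ G.neighborFinset c).card ≤
        ((G.neighborFinset c)ᶜ ∩ (G.neighborFinset y)ᶜ).card := by
      apply Finset.card_le_card
      intro x hx
      rw [Finset.mem_sdiff] at hx
      rw [Finset.mem_inter]
      exact ⟨by simpa using hx.2, hown y (by rw [hyq]; exact hx.1)⟩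
    have h3 := Finset.card_add_card_compl (G.neighborFinset c ∩ G.neighborFinset y)
    rw [Finset.compl_inter, hV] at h3
    have h4 := hm c
    have h5 := hm y
    have h6 : s * (2 * n - 1) + s = 2 * (s * n) := by
      obtain ⟨k, rfl⟩ : ∃ k, n = k + 1 := ⟨n - 1, by omega⟩
      rw [show 2 * (k + 1) - 1 = 2 * k + 1 by omega]; ring
    have h7 : r * n = 2 * (s * n) + 5 * n := by rw [hr]; ring
    omega
  have hS0 : G.IsNClique 2 {c, y} := by
    exact ⟨by simp [SimpleGraph.isClique_iff, Set.pairwise_pair, hcy, hcy.symm],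
      Finset.card_pair hcy.ne⟩
  obtain ⟨S, M, hS, hSM, hMc⟩ := greedy_ext G (2 * n - 1) (2 * n - d + s + 2) (by omega) hm s 2
    {c, y} (G.neighborFinset c ∩ G.neighborFinset y) hS0 (by
      intro x hx z hz
      rw [Finset.mem_inter, SimpleGraph.mem_neighborFinset, SimpleGraph.mem_neighborFinset] at hx
      simp only [Finset.mem_insert, Finset.mem_singleton] at hz
      rcases hz with rfl | rfl
      · exact hx.1.symm
      · exact hx.2.symm) hM
  have hind : ∀ w ∈ M, ∀ z ∈ M, ¬ G.Adj w z := by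
    intro w hw z hz hwz
    have h1 := hS.insert (fun b hb => hSM z hz b hb)
    have h2 := h1.insert (a := w) (by
      intro b hb
      rcases Finset.mem_insert.mp hb with rfl | hb
      · exact hwz
      · exact hSM w hw b hb)
    rw [show 2 + s + 1 + 1 = s + 4 by ring] at h2
    exact hK _ h2
  obtain ⟨w, hw⟩ : M.Nonempty := Finset.card_pos.mp (by omega)
  have hsplit := Finset.card_inter_add_card_sdiff M (part r n w.1)
  have hrest : (M \ part r n w.1).card ≤ n - 1 := by
    apply hout w
    intro x hx
    rw [Finset.mem_sdiff, mem_part] at hx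
    exact ⟨hind w hw x hx.1, hx.2⟩
  have hle : (M ∩ part r n w.1).card ≤ n := by
    exact (Finset.card_le_card Finset.inter_subset_right).trans_eq (card_part r n w.1)
  obtain ⟨z, hz⟩ : (M \ part r n w.1).Nonempty := Finset.card_pos.mp (by omega)
  rw [Finset.mem_sdiff, mem_part] at hz
  have hzd : d ≤ (G.neighborFinset z ∩ part r n w.1).card :=
    hmin (z, w.1) (fun h => hz.2 h.symm)
  have hdisj : Disjoint (M ∩ part r n w.1) (G.neighborFinset z ∩ part r n w.1) := by
    rw [Finset.disjoint_left]
    intro x hx hx2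
    rw [Finset.mem_inter] at hx hx2
    exact hind z hz.1 x hx.1 ((SimpleGraph.mem_neighborFinset _ _ _).mp hx2.1)
  have hfin : ((M ∩ part r n w.1) ∪ (G.neighborFinset z ∩ part r n w.1)).card ≤ n := by
    exact (Finset.card_le_card
      (Finset.union_subset Finset.inter_subset_right Finset.inter_subset_right)).trans_eq
      (card_part r n w.1)
  rw [Finset.card_union_of_disjoint hdisj] at hfin
  omega

/-- The extremal graph: parts are grouped in consecutive pairs. -/
def extremal (r n : ℕ) : SimpleGraph (Fin r × Fin n) where
  Adj v w := v.1.val / 2 ≠ w.1.val / 2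
  symm := ⟨fun _ _ h => h.symm⟩
  loopless := ⟨fun _ h => h rfl⟩

lemma lower (n s r : ℕ) (hn : 1 ≤ n) (hr : r = 2 * s + 5) :
    IsPartite (extremal r n) ∧ (extremal r n).CliqueFree (s + 4) ∧
      (2 * s + 3) * n ≤ (extremal r n).minDegree := by
  refine ⟨?_, ?_, ?_⟩
  · intro v w h h2
    exact h (by rw [h2])
  · have hc : (extremal r n).Colorable (s + 3) :=
      ⟨SimpleGraph.Coloring.mk (fun v => (⟨v.1.val / 2, by omega⟩ : Fin (s + 3))) (by
        intro v w h h2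
        exact h (Fin.mk.inj_iff.mp h2))⟩
    exact hc.cliqueFree (by omega)
  · have : Nonempty (Fin r × Fin n) := ⟨(⟨0, by omega⟩, ⟨0, by omega⟩)⟩
    apply SimpleGraph.le_minDegree_of_forall_le_degree
    intro v
    have h2 := Finset.card_add_card_compl ((extremal r n).neighborFinset v)
    rw [SimpleGraph.card_neighborFinset_eq_degree] at h2
    have hV : Fintype.card (Fin r × Fin n) = r * n := by simp
    have hrn : r * n = (2 * s + 3) * n + 2 * n := by rw [hr]; ring
    have h3 : ((extremal r n).neighborFinset v)ᶜ.card ≤ 2 * n := by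
      have hsub : ((extremal r n).neighborFinset v)ᶜ ⊆
          (Finset.univ.filter (fun i : Fin r => i.val / 2 = v.1.val / 2)) ×ˢ
            (Finset.univ : Finset (Fin n)) := by
        intro x hx
        have hx2 : ¬ (extremal r n).Adj v x := by simpa using hx
        have hx3 : x.1.val / 2 = v.1.val / 2 := by
          by_contra h
          exact hx2 (fun h2 => h h2.symm)
        simp [hx3]
      refine le_trans (Finset.card_le_card hsub) ?_
      rw [Finset.card_product, Finset.card_univ, Fintype.card_fin]
      apply Nat.mul_le_mul_right
      have : (Finset.univ.filter (fun i : Fin r => i.val / 2 = v.1.val / 2)).card ≤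
          ({2 * (v.1.val / 2), 2 * (v.1.val / 2) + 1} : Finset ℕ).card := by
        apply Finset.card_le_card_of_injOn (fun i => i.val)
        · intro i hi
          simp only [Finset.coe_filter, Finset.mem_univ, true_and, Set.mem_ofPred_eq] at hi
          simp only [Finset.coe_insert, Finset.coe_singleton, Set.mem_insert_iff,
            Set.mem_singleton_iff]
          omega
        · intro a _ b _ h
          exact Fin.ext h
      exact le_trans this Finset.card_le_two
    omega

/-- For every `n ≥ 1` and `t ≥ 3`, `f(n, 2t-1, t+1) = (2t-3)·n`. -/
theorem stmt5 (n t : ℕ) (hn : 1 ≤ n) (ht : 3 ≤ t) :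
    f n (2 * t - 1) (t + 1) = (2 * t - 3) * n := by
  obtain ⟨s, rfl⟩ : ∃ s, t = s + 3 := ⟨t - 3, by omega⟩
  have hr : 2 * (s + 3) - 1 = 2 * s + 5 := by omega
  have h3 : 2 * (s + 3) - 3 = 2 * s + 3 := by omega
  obtain ⟨hl1, hl2, hl3⟩ := lower n s _ hn hr
  rw [h3]
  unfold f
  apply le_antisymm
  · apply csSup_le
    · exact ⟨_, _, hl1, hl2, rfl⟩
    · rintro d ⟨G, hP, hK, rfl⟩
      exact upper n s _ hn hr G hP hK
  · refine le_csSup_of_le ⟨(2 * s + 3) * n, ?_⟩ ⟨_, hl1, hl2, rfl⟩ hl3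
    rintro d ⟨G, hP, hK, rfl⟩
    exact upper n s _ hn hr G hP hK
end

section
/- Let $r, n \ge 1$ and $m, t \ge 2$ with $(m-1)t < r < mt$. Then every graph $G$ whose vertex set is partitioned into $r$ independent sets of size $n$ and which has chromatic number at most $t$ satisfies $\delta(G) \le (r-1)n - \lceil \frac{(m-1)(r-1)n}{mt-2} \rceil$. -/
open scoped Classical

theorem aux13 (n q p t M : ℕ) (hn : 1 ≤ n) (hp1 : 1 ≤ p) (hM : M + 2 = (p + 1) * t)
    (h1 : p * t ≤ q) (h2 : q ≤ M) (x : Fin (q + 1) → Fin t → ℕ) (hx : ∀ i, ∑ j, x i j = n) :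
    ∃ i j, 0 < x i j ∧ p * q * n + M * x i j ≤ M * ∑ i', x i' j := by
  by_contra hcon
  push Not at hcon
  have hxn : ∀ i j, x i j ≤ n := fun i j => by
    rw [← hx i]
    exact Finset.single_le_sum (f := fun j => x i j) (fun _ _ => Nat.zero_le _) (Finset.mem_univ j)
  have hS : ∀ j, M * ∑ i', x i' j ≤ (p + 1) * q * n := by
    intro j
    set S := ∑ i', x i' j with hSdef
    set K := Finset.univ.filter (fun i => 0 < x i j) with hK
    have hSK : ∑ i ∈ K, x i j = S := by
      rw [hK, Finset.sum_filter, hSdef]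
      refine Finset.sum_congr rfl fun i _ => ?_
      split_ifs <;> omega
    rcases Nat.lt_or_ge p K.card with hk | hk
    · have hsum : ∑ i ∈ K, M * S ≤ ∑ i ∈ K, (p * q * n + M * x i j) :=
        Finset.sum_le_sum fun i hi => (hcon i j (Finset.mem_filter.1 hi).2).le
      rw [Finset.sum_add_distrib, ← Finset.mul_sum K (fun i => x i j) M, hSK] at hsum
      simp only [Finset.sum_const, smul_eq_mul] at hsum
      obtain ⟨e, he⟩ : ∃ e, K.card = p + 1 + e := ⟨K.card - (p + 1), by omega⟩
      rw [he] at hsum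
      have hpe : 0 < p + e := by omega
      refine Nat.le_of_mul_le_mul_left ?_ hpe
      have h3 : (p + e) * (M * S) ≤ (p + 1 + e) * (p * q * n) := by nlinarith
      refine h3.trans ?_
      have : (p + 1 + e) * p ≤ (p + e) * (p + 1) := by nlinarith
      calc (p + 1 + e) * (p * q * n) = (p + 1 + e) * p * (q * n) := by ring
        _ ≤ (p + e) * (p + 1) * (q * n) := Nat.mul_le_mul_right _ this
        _ = _ := by ring
    · have h3 : S ≤ p * n := by
        rw [← hSK]
        calc ∑ i ∈ K, x i j ≤ K.card • n := Finset.sum_le_card_nsmul _ _ _ fun i _ => hxn i j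
          _ ≤ p * n := Nat.mul_le_mul_right _ hk
      calc M * S ≤ ((p + 1) * t) * (p * n) := Nat.mul_le_mul (by omega) h3
        _ = (p + 1) * (p * t) * n := by ring
        _ ≤ (p + 1) * q * n := Nat.mul_le_mul_right _ (Nat.mul_le_mul_left _ h1)
  by_cases htwo : ∃ i j1 j2, j1 ≠ j2 ∧ 0 < x i j1 ∧ 0 < x i j2
  · obtain ⟨i, j1, j2, hne, hj1, hj2⟩ := htwo
    have htot : ∑ j, M * ∑ i', x i' j = M * ((q + 1) * n) := by
      rw [← Finset.mul_sum, Finset.sum_comm]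
      simp [hx]
    have hMn : ∑ j, M * x i j = M * n := by rw [← Finset.mul_sum, hx]
    have e1 := Finset.add_sum_erase Finset.univ (fun j => M * ∑ i', x i' j) (Finset.mem_univ j1)
    have hm2 : j2 ∈ Finset.univ.erase j1 := by simp [hne.symm]
    have e2 := Finset.add_sum_erase (Finset.univ.erase j1) (fun j => M * ∑ i', x i' j) hm2
    have f1 := Finset.add_sum_erase Finset.univ (fun j => M * x i j) (Finset.mem_univ j1)
    have f2 := Finset.add_sum_erase (Finset.univ.erase j1) (fun j => M * x i j) hm2
    have hrest : ∑ j ∈ (Finset.univ.erase j1).erase j2, M * ∑ i', x i' j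
        ≤ (t - 2) * ((p + 1) * q * n) := by
      refine (Finset.sum_le_card_nsmul _ _ _ fun j _ => hS j).trans ?_
      rw [Finset.card_erase_of_mem hm2, Finset.card_erase_of_mem (Finset.mem_univ _)]
      simp [Nat.sub_sub]
    have g1 := hcon i j1 hj1
    have g2 := hcon i j2 hj2
    have ht2 : 2 ≤ t := by
      have := j1.2; have := j2.2
      have : (j1 : ℕ) ≠ j2 := fun h => hne (Fin.ext h)
      omega
    obtain ⟨s, rfl⟩ : ∃ s, t = s + 2 := ⟨t - 2, by omega⟩
    have hMe : M = (p + 1) * s + 2 * p := by nlinarith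
    have hfin : M * (q * n) = s * ((p + 1) * q * n) + 2 * (p * q * n) := by rw [hMe]; ring
    have hexp : M * ((q + 1) * n) = M * (q * n) + M * n := by ring
    simp only [Nat.add_sub_cancel] at hrest
    omega
  · push Not at htwo
    have hex : ∀ i, ∃ j, x i j = n := by
      intro i
      have : ∃ j, 0 < x i j := by
        by_contra hc
        push Not at hc
        have : ∑ j, x i j = 0 := Finset.sum_eq_zero fun j _ => Nat.le_zero.1 (hc j)
        rw [hx] at this; omega
      obtain ⟨j, hj⟩ := this
      refine ⟨j, ?_⟩
      rw [← hx i]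
      refine (Finset.sum_eq_single j (fun b _ hb => ?_) (by simp)).symm
      exact Nat.le_zero.1 (htwo i j b hb.symm hj)
    choose f hf using hex
    obtain ⟨j, -, hj⟩ := Finset.exists_lt_card_fiber_of_mul_lt_card_of_maps_to
      (s := (Finset.univ : Finset (Fin (q + 1)))) (t := (Finset.univ : Finset (Fin t))) (f := f)
      (n := p) (fun _ _ => Finset.mem_univ _) (by simp; nlinarith)
    have hne : (Finset.univ.filter (fun i => f i = j)).Nonempty := Finset.card_pos.1 (by omega)
    obtain ⟨i, hi⟩ := hne
    have hij : x i j = n := by rw [← (Finset.mem_filter.1 hi).2]; exact hf i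
    have g := hcon i j (by omega)
    have hlow : (p + 1) * n ≤ ∑ i', x i' j := by
      calc (p + 1) * n ≤ (Finset.univ.filter (fun i => f i = j)).card * n :=
            Nat.mul_le_mul_right _ hj
        _ = ∑ i' ∈ Finset.univ.filter (fun i => f i = j), x i' j := by
            rw [Finset.sum_congr rfl (g := fun _ => n)]
            · simp
            · intro a ha
              rw [← (Finset.mem_filter.1 ha).2]; exact hf a
        _ ≤ _ := Finset.sum_le_sum_of_subset (Finset.filter_subset _ _)
    have k1 := Nat.mul_le_mul_left M hlow
    have k2 : p * q * n ≤ p * M * n := Nat.mul_le_mul_right _ (Nat.mul_le_mul_left _ h2)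
    rw [hij] at g
    nlinarith

/-- Let `(m-1)t < r < mt` with `m, t ≥ 2`. Every `r`-partite graph with parts of size `n`
and chromatic number at most `t` satisfies `δ(G) ≤ (r-1)n - ⌈(m-1)(r-1)n/(mt-2)⌉`. -/
theorem stmt13 (n r m t : ℕ) (hn : 1 ≤ n) (hr : 1 ≤ r) (hm : 2 ≤ m) (ht : 2 ≤ t)
    (h1 : (m - 1) * t < r) (h2 : r < m * t)
    (G : SimpleGraph (Fin r × Fin n)) (hp : IsPartite G)
    (hχ : G.chromaticNumber ≤ (t : ℕ∞)) :
    G.minDegree ≤ (r - 1) * n - ((m - 1) * (r - 1) * n) ⌈/⌉ (m * t - 2) := by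
  obtain ⟨C⟩ := SimpleGraph.chromaticNumber_le_iff_colorable.1 hχ
  obtain ⟨p, rfl⟩ : ∃ p, m = p + 1 := ⟨m - 1, by omega⟩
  obtain ⟨q, rfl⟩ : ∃ q, r = q + 1 := ⟨r - 1, by omega⟩
  have hmt : 2 * 2 ≤ (p + 1) * t := Nat.mul_le_mul hm ht
  obtain ⟨M, hM⟩ : ∃ M, (p + 1) * t = M + 2 := ⟨(p + 1) * t - 2, by omega⟩
  simp only [Nat.add_sub_cancel] at h1 ⊢
  rw [hM, Nat.add_sub_cancel]
  let A : Fin (q + 1) → Fin t → Finset (Fin (q + 1) × Fin n) :=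
    fun i j => Finset.univ.filter (fun v => v.1 = i ∧ C v = j)
  have hV : ∀ i : Fin (q + 1),
      (Finset.univ.filter (fun v : Fin (q + 1) × Fin n => v.1 = i)).card = n := by
    intro i
    have : Finset.univ.filter (fun v : Fin (q + 1) × Fin n => v.1 = i)
        = {i} ×ˢ (Finset.univ : Finset (Fin n)) := by
      ext v; simp only [Finset.mem_filter, Finset.mem_univ, true_and, Finset.mem_product, Finset.mem_singleton, and_true]
    rw [this]; simp
  obtain ⟨i, j, hpos, hle⟩ := aux13 n q p t M hn (by omega) hM.symm (by omega) (by omega)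
    (fun i j => (A i j).card) (by
      intro i
      refine Eq.trans ?_ (hV i)
      rw [Finset.card_eq_sum_card_fiberwise (f := C) (t := Finset.univ)
        (fun _ _ => by simp)]
      simp [A, Finset.filter_filter])
  have hC : ∑ i', (A i' j).card = (Finset.univ.filter (fun v => C v = j)).card := by
    rw [Finset.card_eq_sum_card_fiberwise (f := Prod.fst) (t := Finset.univ)
        (fun _ _ => by simp)]
    simp [A, Finset.filter_filter, and_comm]
  rw [hC] at hle
  obtain ⟨v, hv⟩ := Finset.card_pos.1 hpos
  obtain ⟨-, hv1, hv2⟩ := Finset.mem_filter.1 hv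
  set P := Finset.univ.filter (fun v : Fin (q + 1) × Fin n => v.1 = i) with hP
  set Q := Finset.univ.filter (fun v => C v = j) with hQ
  have hPQ : A i j = P ∩ Q := by
    ext w; simp [A, hP, hQ]
  have hun := Finset.card_union_add_card_inter P Q
  rw [← hPQ, hV i] at hun
  have hdis : Disjoint (G.neighborFinset v) (P ∪ Q) := by
    rw [Finset.disjoint_left]
    intro w hw hw'
    rw [SimpleGraph.mem_neighborFinset] at hw
    rcases Finset.mem_union.1 hw' with h | h
    · exact hp v w hw (hv1.trans (Finset.mem_filter.1 h).2.symm)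
    · exact C.valid hw (hv2.trans (Finset.mem_filter.1 h).2.symm)
  have hcard := Finset.card_le_univ (G.neighborFinset v ∪ (P ∪ Q))
  rw [Finset.card_union_of_disjoint hdis, SimpleGraph.card_neighborFinset_eq_degree] at hcard
  simp only [Fintype.card_prod, Fintype.card_fin] at hcard
  have hmin := G.minDegree_le_degree v
  have hMpos : 0 < M := by omega
  have hAQ : (A i j).card ≤ Q.card := by
    rw [hPQ]; exact Finset.card_le_card Finset.inter_subset_right
  have hceil : (p * q * n) ⌈/⌉ M ≤ Q.card - (A i j).card := by
    rw [ceilDiv_le_iff_le_mul hMpos]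
    rw [Nat.mul_sub]
    omega
  have : (q + 1) * n = q * n + n := by ring
  omega
end

section
/- For integers $n \ge 1$, $m \ge 2$, $t \ge 3$ and $r = mt - 1$: $f(n,r,t+1) = (r - \lceil r/t \rceil)n = (r-m)n$. -/
open scoped Classical

/-- `deltaP n r t` : the largest minimum degree among `r`-partite graphs with parts
of size `n` and chromatic number at most `t`. -/
noncomputable def deltaP (n r t : ℕ) : ℕ :=
  sSup {d | ∃ G : SimpleGraph (Fin r × Fin n),
    IsPartite G ∧ G.chromaticNumber ≤ (t : ℕ∞) ∧ G.minDegree = d}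

namespace MPart

open Finset

variable {V ι : Type*} [Fintype V]

/-- Fiber of a part. -/
noncomputable def fib (p : V → ι) (i : ι) : Finset V := univ.filter (fun v => p v = i)

/-- Vertices in the parts of `A`. -/
noncomputable def VA (p : V → ι) (A : Finset ι) : Finset V := univ.filter (fun v => p v ∈ A)

/-- Missing neighbours in other parts. -/
noncomputable def M (G : SimpleGraph V) (p : V → ι) (v : V) : Finset V :=
  univ.filter (fun w => p w ≠ p v ∧ ¬ G.Adj v w)

structure Good (G : SimpleGraph V) (p : V → ι) (n : ℕ) : Prop where
  pos : 1 ≤ n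
  part : ∀ v w, G.Adj v w → p v ≠ p w
  fib : ∀ i, #(fib p i) = n
  miss : ∀ v, #(M G p v) + 1 ≤ n

def HasClique (G : SimpleGraph V) (p : V → ι) (A : Finset ι) (s : ℕ) : Prop :=
  ∃ X : Finset V, G.IsNClique s X ∧ ∀ x ∈ X, p x ∈ A

variable {G : SimpleGraph V} {p : V → ι} {n : ℕ}

lemma mem_fib {i : ι} {v : V} : v ∈ fib p i ↔ p v = i := by simp [fib]
lemma mem_VA {A : Finset ι} {v : V} : v ∈ VA p A ↔ p v ∈ A := by simp [VA]
lemma mem_M {v w : V} : w ∈ M G p v ↔ p w ≠ p v ∧ ¬ G.Adj v w := by simp [M]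

lemma M_symm {v w : V} : w ∈ M G p v ↔ v ∈ M G p w := by
  simp only [mem_M, G.adj_comm v w, ne_comm]

lemma Good.card_VA (h : Good G p n) (A : Finset ι) : #(VA p A) = #A * n := by
  rw [Finset.card_eq_sum_card_fiberwise (f := p) (t := A) (fun v hv => by simpa [mem_VA] using hv)]
  rw [Finset.sum_const_nat (m := n)]
  intro i hi
  rw [← h.fib i]
  congr 1
  ext v
  simp only [mem_filter, mem_VA, mem_fib]
  constructor
  · exact fun h => h.2
  · rintro rfl; exact ⟨hi, rfl⟩

lemma Good.nonadj (h : Good G p n) (x : V) (S : Finset V) :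
    #(S.filter (fun v => ¬ G.Adj x v)) + 1 ≤ 2 * n := by
  have : S.filter (fun v => ¬ G.Adj x v) ⊆ MPart.fib p (p x) ∪ M G p x := by
    intro v
    simp only [mem_filter, mem_union, mem_fib, mem_M]
    tauto
  have h1 := (card_le_card this).trans (card_union_le _ _)
  have := h.fib (p x)
  have := h.miss x
  omega

/-- degree into a part -/
noncomputable def e (G : SimpleGraph V) (p : V → ι) (x : V) (l : ι) : ℕ :=
  #((fib p l).filter (fun v => G.Adj x v))

lemma Good.deg2 (h : Good G p n) {x : V} {l l' : ι} (h1 : p x ≠ l) (h2 : p x ≠ l') (h3 : l ≠ l') :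
    n + 1 ≤ e G p x l + e G p x l' := by
  have a := card_filter_add_card_filter_not (s := MPart.fib p l) (fun v => G.Adj x v)
  have b := card_filter_add_card_filter_not (s := MPart.fib p l') (fun v => G.Adj x v)
  have c : (MPart.fib p l).filter (fun v => ¬ G.Adj x v) ∪ (MPart.fib p l').filter (fun v => ¬ G.Adj x v) ⊆ M G p x := by
    intro v
    simp only [mem_union, mem_filter, mem_fib, mem_M]
    rintro (⟨rfl, h⟩ | ⟨rfl, h⟩)
    · exact ⟨h1.symm, h⟩
    · exact ⟨h2.symm, h⟩
  have d := card_le_card c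
  rw [card_union_of_disjoint] at d
  · have := h.fib l
    have := h.fib l'
    have := h.miss x
    unfold e
    omega
  · rw [disjoint_left]
    intro v
    simp only [mem_filter, mem_fib]
    rintro ⟨rfl, _⟩ ⟨h, _⟩
    exact h3 h

lemma Good.base (h : Good G p n) (A : Finset ι) (hA : #A = 3) : HasClique G p A 3 := by
  have hne : ((VA p A ×ˢ A).filter (fun q => p q.1 ≠ q.2)).Nonempty := by
    obtain ⟨a, b, hab⟩ := Finset.one_lt_card_iff.1 (show 1 < #A by omega)
    have : (MPart.fib p a).Nonempty := by
      rw [← card_pos, h.fib]; exact h.pos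
    obtain ⟨x, hx⟩ := this
    rw [mem_fib] at hx
    refine ⟨(x, b), ?_⟩
    simp [mem_VA, hx, hab]
  obtain ⟨⟨x, l⟩, hxl, hmax⟩ := exists_max_image _ (fun q : V × ι => e G p q.1 q.2) hne
  simp only [mem_filter, mem_product, mem_VA] at hxl
  obtain ⟨⟨hx, hl⟩, hne⟩ := hxl
  obtain ⟨l', hl', hl'2⟩ : ∃ l' ∈ A, l' ∉ ({p x, l} : Finset ι) := by
    apply exists_mem_notMem_of_card_lt_card
    have := card_le_two (a := p x) (b := l)
    omega
  simp only [mem_insert, mem_singleton, not_or] at hl'2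
  have d1 := h.deg2 hne (Ne.symm hl'2.1) (Ne.symm hl'2.2)
  have d0 : e G p x l ≤ n := by
    rw [← h.fib l]; exact card_filter_le _ _
  have : ((MPart.fib p l').filter (fun v => G.Adj x v)).Nonempty := by
    rw [← card_pos]; unfold e at *; omega
  obtain ⟨y, hy⟩ := this
  simp only [mem_filter, mem_fib] at hy
  obtain ⟨hy, hxy⟩ := hy
  have d2 := hmax (y, p x) (by simp [mem_VA, hy, hl', hx, hl'2.1])
  simp only at d2
  have d3 := h.deg2 (x := y) (l := p x) (l' := l) (by rw [hy]; exact hl'2.1) (by rw [hy]; exact hl'2.2) hne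
  have : ((MPart.fib p l).filter (fun v => G.Adj x v) ∩ (MPart.fib p l).filter (fun v => G.Adj y v)).Nonempty := by
    rw [← card_pos]
    have u := card_union_add_card_inter ((MPart.fib p l).filter (fun v => G.Adj x v)) ((MPart.fib p l).filter (fun v => G.Adj y v))
    have : #((MPart.fib p l).filter (fun v => G.Adj x v) ∪ (MPart.fib p l).filter (fun v => G.Adj y v)) ≤ n := by
      rw [← h.fib l]
      exact card_le_card (union_subset (filter_subset _ _) (filter_subset _ _))
    unfold e at *
    omega
  obtain ⟨z, hz⟩ := this
  simp only [mem_inter, mem_filter, mem_fib] at hz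
  obtain ⟨⟨hz, hxz⟩, -, hyz⟩ := hz
  refine ⟨{x, y, z}, SimpleGraph.is3Clique_triple_iff.2 ⟨hxy, hxz, hyz⟩, ?_⟩
  simp [hx, hy, hz, hl, hl']

lemma Good.parts_le_two (h : Good G p n) (K : Finset V) (hK : ∀ a ∈ K, ∀ b ∈ K, ¬ G.Adj a b)
    (hc : 3 * n ≤ 2 * #K + 2) : #(K.image p) ≤ 2 := by
  by_contra hcon
  obtain ⟨a, b, c, ha, hb, hc', hab, hac, hbc⟩ := two_lt_card_iff.1 (not_le.1 hcon)
  have key : ∀ i ∈ K.image p, #K + 1 ≤ #(K.filter (fun v => p v = i)) + n := by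
    intro i hi
    obtain ⟨k, hk, rfl⟩ := mem_image.1 hi
    have := card_filter_add_card_filter_not (s := K) (fun v => p v = p k)
    have h2 : #(K.filter (fun v => ¬ p v = p k)) ≤ #(M G p k) := by
      apply card_le_card
      intro v hv
      rw [mem_filter] at hv
      exact mem_M.2 ⟨hv.2, hK _ hk _ hv.1⟩
    have := h.miss k
    omega
  have s : #(K.filter (fun v => p v = a)) + #(K.filter (fun v => p v = b)) + #(K.filter (fun v => p v = c)) ≤ #K := by
    rw [← card_union_of_disjoint, ← card_union_of_disjoint]
    · apply card_le_card
      simp [union_subset_iff, filter_subset]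
    · rw [disjoint_left]; intro v; simp only [mem_union, mem_filter]
      rintro (⟨_, rfl⟩ | ⟨_, rfl⟩) ⟨_, h⟩
      · exact hac h
      · exact hbc h
    · rw [disjoint_left]; intro v; simp only [mem_filter]
      rintro ⟨_, rfl⟩ ⟨_, h⟩
      exact hab h
  have := key a ha
  have := key b hb
  have := key c hc'
  omega

/-- number of vertices of `X` missing `v` -/
noncomputable def c (G : SimpleGraph V) (p : V → ι) (X : Finset V) (v : V) : ℕ :=
  #(X.filter (fun x => v ∈ M G p x))

lemma Good.sum_c_le (h : Good G p n) (X S : Finset V) :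
    ∑ v ∈ S, c G p X v + #X ≤ #X * n := by
  have : ∑ v ∈ S, c G p X v = ∑ x ∈ X, #(S.filter (fun v => v ∈ M G p x)) := by
    simp only [c, card_filter]
    exact sum_comm
  rw [this, card_eq_sum_ones, ← sum_add_distrib, sum_mul]
  apply sum_le_sum
  intro x _
  have := h.miss x
  have : #(S.filter (fun v => v ∈ M G p x)) ≤ #(M G p x) :=
    card_le_card (fun v hv => (mem_filter.1 hv).2)
  omega

lemma adj_of_notMem {v x : V} (h1 : p v ≠ p x) (h2 : v ∉ M G p x) : G.Adj x v := by
  by_contra h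
  exact h2 (mem_M.2 ⟨h1, h⟩)

lemma Good.c_pos (X : Finset V) {A : Finset ι} {s : ℕ}
    (hX : G.IsNClique s X) (hXA : ∀ x ∈ X, p x ∈ A) (hno : ¬ HasClique G p A (s + 1))
    {v : V} (hv : p v ∈ A) (hvX : p v ∉ X.image p) : 1 ≤ c G p X v := by
  rw [c, Nat.one_le_iff_ne_zero, Finset.card_ne_zero]
  by_contra hcon
  rw [not_nonempty_iff_eq_empty, filter_eq_empty_iff] at hcon
  apply hno
  refine ⟨insert v X, hX.insert ?_, ?_⟩
  · intro x hx
    refine (adj_of_notMem ?_ (hcon hx)).symm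
    intro h
    exact hvX (mem_image.2 ⟨x, hx, h.symm⟩)
  · intro x hx
    rcases mem_insert.1 hx with rfl | hx
    · exact hv
    · exact hXA x hx

lemma Good.single (h : Good G p n) {A B : Finset ι} {K X : Finset V} {s : ℕ}
    (hX : G.IsNClique (s + 1) X) (hXA : ∀ x ∈ X, p x ∈ A) (hXB : ∀ x ∈ X, p x ∉ B)
    (hBA : B ⊆ A) (hno : ¬ HasClique G p A (s + 2))
    (hKi : ∀ a ∈ K, ∀ b ∈ K, ¬ G.Adj a b) (hKB : ∀ k ∈ K, p k ∈ B)
    {x k : V} (hk : k ∈ K) (hx : X.filter (fun x => k ∈ M G p x) = {x}) :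
    #K + 1 ≤ ∑ v ∈ MPart.fib p (p x), c G p X v + n := by
  have hxm : x ∈ X ∧ k ∈ M G p x := by
    have : x ∈ X.filter (fun x => k ∈ M G p x) := by rw [hx]; simp
    simpa using this
  obtain ⟨hxX, hkx⟩ := hxm
  have hother : ∀ y ∈ X, y ≠ x → k ∉ M G p y := by
    intro y hy hyx hky
    have : y ∈ X.filter (fun x => k ∈ M G p x) := by simp [hy, hky]
    rw [hx] at this
    exact hyx (by simpa using this)
  set Z := (MPart.fib p (p x)).filter (fun v => c G p X v = 0) with hZ
  have hZM : Z ∪ K.filter (fun v => ¬ p v = p k) ⊆ M G p k := by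
    intro v hv
    rcases mem_union.1 hv with hv | hv
    · rw [hZ, mem_filter, mem_fib] at hv
      obtain ⟨hvx, hcv⟩ := hv
      refine mem_M.2 ⟨?_, ?_⟩
      · intro hvk
        exact hXB x hxX (by rw [← hvx, hvk]; exact hKB k hk)
      · intro hkv
        apply hno
        rw [c, card_eq_zero, filter_eq_empty_iff] at hcv
        have hXx : G.IsNClique s (X.erase x) := by
          simpa using hX.erase_of_mem hxX
        have hvc : G.IsNClique (s + 1) (insert v (X.erase x)) := by
          apply hXx.insert
          intro y hy
          obtain ⟨hyx, hy⟩ := mem_erase.1 hy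
          refine (adj_of_notMem ?_ (hcv hy)).symm
          rw [hvx]
          exact h.part _ _ (hX.1 hxX hy hyx.symm)
        refine ⟨insert k (insert v (X.erase x)), hvc.insert ?_, ?_⟩
        · intro y hy
          rcases mem_insert.1 hy with rfl | hy
          · exact hkv
          · obtain ⟨hyx, hy⟩ := mem_erase.1 hy
            refine (adj_of_notMem ?_ (hother y hy hyx)).symm
            intro hky
            exact hXB y hy (hky ▸ hKB k hk)
        · intro y hy
          rcases mem_insert.1 hy with rfl | hy
          · exact hBA (hKB _ hk)
          rcases mem_insert.1 hy with rfl | hy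
          · rw [hvx]; exact hXA x hxX
          · exact hXA y (mem_of_mem_erase hy)
    · rw [mem_filter] at hv
      exact mem_M.2 ⟨hv.2, hKi _ hk _ hv.1⟩
  have hd : Disjoint Z (K.filter (fun v => ¬ p v = p k)) := by
    rw [disjoint_left]
    intro v hv hv'
    rw [hZ, mem_filter, mem_fib] at hv
    rw [mem_filter] at hv'
    exact hXB x hxX (hv.1 ▸ hKB v hv'.1)
  have h1 := card_le_card hZM
  rw [card_union_of_disjoint hd] at h1
  have h2 := h.miss k
  have h3 := card_filter_add_card_filter_not (s := K) (fun v => p v = p k)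
  have h4 : #(K.filter (fun v => p v = p k)) ≤ n := by
    rw [← h.fib (p k)]
    apply card_le_card
    intro v hv
    exact mem_fib.2 (mem_filter.1 hv).2
  have h5 : n ≤ #Z + ∑ v ∈ MPart.fib p (p x), c G p X v := by
    rw [← h.fib (p x), hZ, card_filter, ← sum_add_distrib, card_eq_sum_ones]
    apply sum_le_sum
    intro v _
    split_ifs <;> omega
  omega

theorem Good.propA (h : Good G p n) {s : ℕ} (hs : 2 ≤ s)
    (hP : ∀ A : Finset ι, #A = 2 * s - 1 → HasClique G p A (s + 1))
    (A : Finset ι) (hA : #A = 2 * s + 1) (K : Finset V) (hKA : ∀ k ∈ K, p k ∈ A)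
    (hKi : ∀ a ∈ K, ∀ b ∈ K, ¬ G.Adj a b) (hc : 3 * n ≤ 2 * #K + 2) :
    HasClique G p A (s + 2) := by
  by_contra hno
  have hn := h.pos
  obtain ⟨B, hB1, hBA, hB2⟩ : ∃ B, K.image p ⊆ B ∧ B ⊆ A ∧ #B = 2 := by
    apply exists_subsuperset_card_eq
    · intro i hi
      obtain ⟨k, hk, rfl⟩ := mem_image.1 hi
      exact hKA k hk
    · exact h.parts_le_two K hKi hc
    · omega
  have hKB : ∀ k ∈ K, p k ∈ B := fun k hk => hB1 (mem_image_of_mem p hk)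
  obtain ⟨X, hX, hXAB⟩ := hP (A \ B) (by rw [card_sdiff_of_subset hBA]; omega)
  have hXA : ∀ x ∈ X, p x ∈ A := fun x hx => (mem_sdiff.1 (hXAB x hx)).1
  have hXB : ∀ x ∈ X, p x ∉ B := fun x hx => (mem_sdiff.1 (hXAB x hx)).2
  have hinj : Set.InjOn p X := by
    intro x hx y hy hxy
    by_contra hne
    exact h.part _ _ (hX.1 hx hy hne) hxy
  have hcX : #X = s + 1 := hX.2
  have himg : #(X.image p) = s + 1 := by rw [card_image_of_injOn hinj, hcX]
  have himgA : X.image p ⊆ A := by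
    intro i hi
    obtain ⟨k, hk, rfl⟩ := mem_image.1 hi
    exact hXA k hk
  set R := A \ X.image p with hR
  have hRc : #R = s := by rw [hR, card_sdiff_of_subset himgA]; omega
  have hKR : K ⊆ VA p R := by
    intro k hk
    rw [mem_VA, hR, mem_sdiff]
    refine ⟨hKA k hk, ?_⟩
    intro hi
    obtain ⟨x, hx, hxk⟩ := mem_image.1 hi
    exact hXB x hx (hxk ▸ hKB k hk)
  have hpos : ∀ v ∈ VA p R, 1 ≤ c G p X v := by
    intro v hv
    rw [mem_VA, hR, mem_sdiff] at hv
    exact Good.c_pos X hX hXA hno hv.1 hv.2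
  -- lower bound on the sum over `VA R`
  set K2 := K.filter (fun k => c G p X k ≠ 1) with hK2
  have hsR : s * n + #K2 ≤ ∑ v ∈ VA p R, c G p X v := by
    have e1 : #K2 = ∑ v ∈ VA p R, (if v ∈ K2 then 1 else 0) := by
      rw [← card_filter]
      congr 1
      ext v
      exact ⟨fun hv => mem_filter.2 ⟨hKR (mem_filter.1 hv).1, hv⟩, fun hv => (mem_filter.1 hv).2⟩
    rw [← hRc, ← h.card_VA R, card_eq_sum_ones, e1, ← sum_add_distrib]
    apply sum_le_sum
    intro v hv
    have := hpos v hv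
    split_ifs with hv2
    · rw [hK2, mem_filter] at hv2
      omega
    · omega
  -- total
  have htot : ∀ Y ⊆ X, ∑ v ∈ VA p R, c G p X v + ∑ x ∈ Y, ∑ v ∈ MPart.fib p (p x), c G p X v
      + (s + 1) ≤ (s + 1) * n := by
    intro Y hY
    have := h.sum_c_le X (VA p R ∪ Y.biUnion (fun x => MPart.fib p (p x)))
    rw [hcX, sum_union, sum_biUnion] at this
    · exact this
    · intro x hx y hy hxy
      rw [Function.onFun, disjoint_left]
      intro v hv hv'
      rw [mem_fib] at hv hv'
      exact hxy (hinj (hY hx) (hY hy) (hv ▸ hv'))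
    · rw [disjoint_left]
      intro v hv hv'
      rw [mem_VA, hR, mem_sdiff] at hv
      obtain ⟨x, hx, hv'⟩ := mem_biUnion.1 hv'
      rw [mem_fib] at hv'
      exact hv.2 (hv' ▸ mem_image_of_mem p (hY hx))
  have hsing : ∀ k ∈ K, k ∉ K2 → ∃ x ∈ X, X.filter (fun x => k ∈ M G p x) = {x} := by
    intro k hk hk2
    have : c G p X k = 1 := by
      by_contra hne
      exact hk2 (by rw [hK2, mem_filter]; exact ⟨hk, hne⟩)
    rw [c, card_eq_one] at this
    obtain ⟨x, hx⟩ := this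
    refine ⟨x, ?_, hx⟩
    have : x ∈ X.filter (fun x => k ∈ M G p x) := by rw [hx]; simp
    exact (mem_filter.1 this).1
  have hK2c := card_sdiff_add_card_eq_card (show K2 ⊆ K from filter_subset _ _)
  have hexp : (s + 1) * n = s * n + n := by ring
  by_cases hall : K \ K2 = ∅
  · have h0 := htot ∅ (empty_subset _)
    rw [hall] at hK2c
    simp only [sum_empty, card_empty] at h0 hK2c
    omega
  obtain ⟨k, hk⟩ := nonempty_iff_ne_empty.2 hall
  rw [mem_sdiff] at hk
  obtain ⟨x, hxX, hx⟩ := hsing k hk.1 hk.2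
  have s1 := h.single hX hXA hXB hBA hno hKi hKB hk.1 hx
  by_cases hsub : K \ K2 ⊆ M G p x
  · have h0 := htot {x} (by simpa using hxX)
    have h1 := card_le_card hsub
    have h2 := h.miss x
    simp only [sum_singleton] at h0
    omega
  · obtain ⟨k', hk', hk'x⟩ := not_subset.1 hsub
    rw [mem_sdiff] at hk'
    obtain ⟨y, hyX, hy⟩ := hsing k' hk'.1 hk'.2
    have s2 := h.single hX hXA hXB hBA hno hKi hKB hk'.1 hy
    have hxy : x ≠ y := by
      rintro rfl
      apply hk'x
      have : x ∈ X.filter (fun x => k' ∈ M G p x) := by rw [hy]; simp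
      exact (mem_filter.1 this).2
    have h0 := htot {x, y} (by
      intro z hz
      rcases mem_insert.1 hz with rfl | hz
      · exact hxX
      · rw [mem_singleton.1 hz]; exact hyX)
    rw [sum_pair hxy] at h0
    omega

/-- Existence of a large independent set for `t ≥ 4`. -/
theorem Good.exK (h : Good G p n) {s : ℕ} (hs : 3 ≤ s)
    (hP : ∀ A : Finset ι, #A = 2 * s - 1 → HasClique G p A (s + 1))
    (A : Finset ι) (hA : #A = 2 * s + 1) (hno : ¬ HasClique G p A (s + 2)) :
    ∃ K : Finset V, (∀ k ∈ K, p k ∈ A) ∧ (∀ a ∈ K, ∀ b ∈ K, ¬ G.Adj a b) ∧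
      3 * n ≤ 2 * #K + 2 := by
  obtain ⟨A', hA', hA'c⟩ := exists_subset_card_eq (s := A) (n := 2 * s - 1) (by omega)
  obtain ⟨X, hX, hXA'⟩ := hP A' hA'c
  have hXA : ∀ x ∈ X, p x ∈ A := fun x hx => hA' (hXA' x hx)
  have hcX : #X = s + 1 := hX.2
  let d : V → Finset V := fun v => X.filter (fun x => ¬ G.Adj x v)
  have hsum : ∑ v ∈ VA p A, #(d v) + (s + 1) ≤ (s + 1) * (2 * n) := by
    have : ∑ v ∈ VA p A, #(d v) = ∑ x ∈ X, #((VA p A).filter (fun v => ¬ G.Adj x v)) := by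
      simp only [d, card_filter]
      exact sum_comm
    rw [this, ← hcX, card_eq_sum_ones X, ← sum_add_distrib, sum_mul]
    apply sum_le_sum
    intro x _
    have := h.nonadj x (VA p A)
    omega
  have hpos : ∀ v ∈ VA p A, 1 ≤ #(d v) := by
    intro v hv
    rw [Nat.one_le_iff_ne_zero, Finset.card_ne_zero]
    by_contra hcon
    rw [not_nonempty_iff_eq_empty, filter_eq_empty_iff] at hcon
    apply hno
    refine ⟨insert v X, hX.insert ?_, ?_⟩
    · intro x hx
      have := hcon hx
      rw [not_not] at this
      exact this.symm
    · intro x hx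
      rcases mem_insert.1 hx with rfl | hx
      · exact mem_VA.1 hv
      · exact hXA x hx
  let S := (VA p A).filter (fun v => #(d v) = 1)
  have hS : 2 * #(VA p A) ≤ ∑ v ∈ VA p A, #(d v) + #S := by
    simp only [S]
    rw [card_filter, ← sum_add_distrib, card_eq_sum_ones, mul_sum]
    apply sum_le_sum
    intro v hv
    have := hpos v hv
    split_ifs <;> omega
  have hSx : #S ≤ ∑ x ∈ X, #(S.filter (fun v => d v = {x})) := by
    have : S ⊆ X.biUnion (fun x => S.filter (fun v => d v = {x})) := by
      intro v hv
      have h1 := (mem_filter.1 hv).2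
      obtain ⟨x, hx⟩ := card_eq_one.1 h1
      rw [mem_biUnion]
      refine ⟨x, ?_, mem_filter.2 ⟨hv, hx⟩⟩
      have : x ∈ d v := by rw [hx]; simp
      exact (mem_filter.1 this).1
    exact (card_le_card this).trans card_biUnion_le
  rw [h.card_VA, hA] at hS
  have hex : ∃ x ∈ X, 3 * n ≤ 2 * #(S.filter (fun v => d v = {x})) + 2 := by
    by_contra! hcon
    have h2 : ∑ x ∈ X, (2 * #(S.filter (fun v => d v = {x})) + 3) ≤ ∑ x ∈ X, 3 * n := by
      apply sum_le_sum
      intro x hx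
      have := hcon x hx
      omega
    rw [sum_add_distrib, ← mul_sum, sum_const, sum_const, hcX, smul_eq_mul, smul_eq_mul] at h2
    have hn := h.pos
    nlinarith
  obtain ⟨x, hxX, hx⟩ := hex
  refine ⟨_, ?_, ?_, hx⟩
  · intro k hk
    exact mem_VA.1 (mem_filter.1 (mem_filter.1 hk).1).1
  · intro a ha b hb hab
    have key : ∀ a ∈ S.filter (fun v => d v = {x}), ∀ y ∈ X, y ≠ x → G.Adj y a := by
      intro a ha y hy hyx
      by_contra hna
      have : y ∈ d a := mem_filter.2 ⟨hy, hna⟩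
      rw [(mem_filter.1 ha).2] at this
      exact hyx (by simpa using this)
    apply hno
    have hXx : G.IsNClique s (X.erase x) := by
      simpa using hX.erase_of_mem hxX
    have hvc : G.IsNClique (s + 1) (insert b (X.erase x)) := by
      apply hXx.insert
      intro y hy
      obtain ⟨hyx, hy⟩ := mem_erase.1 hy
      exact (key b hb y hy hyx).symm
    refine ⟨insert a (insert b (X.erase x)), hvc.insert ?_, ?_⟩
    · intro y hy
      rcases mem_insert.1 hy with rfl | hy
      · exact hab
      · obtain ⟨hyx, hy⟩ := mem_erase.1 hy
        exact (key a ha y hy hyx).symm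
    · intro y hy
      rcases mem_insert.1 hy with rfl | hy
      · exact mem_VA.1 (mem_filter.1 (mem_filter.1 ha).1).1
      rcases mem_insert.1 hy with rfl | hy
      · exact mem_VA.1 (mem_filter.1 (mem_filter.1 hb).1).1
      · exact hXA y (mem_of_mem_erase hy)

section K4

variable {W : Type*} {H : SimpleGraph W}

lemma k4 (hcf : H.CliqueFree 4) {a b x y : W} (hab : H.Adj a b) (hax : H.Adj a x)
    (hbx : H.Adj b x) (hay : H.Adj a y) (hby : H.Adj b y) (hxy : H.Adj x y) : False := by
  have h3 : H.IsNClique 3 {a, b, x} := SimpleGraph.is3Clique_triple_iff.2 ⟨hab, hax, hbx⟩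
  refine hcf _ (h3.insert (a := y) ?_)
  intro z hz
  simp only [mem_insert, mem_singleton] at hz
  rcases hz with rfl | rfl | rfl
  · exact hay.symm
  · exact hby.symm
  · exact hxy.symm

variable [Fintype W]

/-- common neighbourhood -/
noncomputable def cn (H : SimpleGraph W) (a b : W) : Finset W :=
  univ.filter (fun x => H.Adj a x ∧ H.Adj b x)

/-- nonneighbours -/
noncomputable def nn (H : SimpleGraph W) (a : W) : Finset W :=
  univ.filter (fun x => ¬ H.Adj a x)

lemma cn_indep (hcf : H.CliqueFree 4) {a b : W} (hab : H.Adj a b) :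
    ∀ x ∈ cn H a b, ∀ y ∈ cn H a b, ¬ H.Adj x y := by
  intro x hx y hy hxy
  simp only [cn, mem_filter, mem_univ, true_and] at hx hy
  exact k4 hcf hab hx.1 hx.2 hy.1 hy.2 hxy

lemma wheel_count (hcf : H.CliqueFree 4) {h a b c d e : W}
    (ha : H.Adj h a) (hb : H.Adj h b) (hc : H.Adj h c) (hd : H.Adj h d) (he : H.Adj h e)
    (hab : H.Adj a b) (hbc : H.Adj b c) (hcd : H.Adj c d) (hde : H.Adj d e) (hea : H.Adj e a) :
    6 * Fintype.card W ≤ #(cn H a b) + #(cn H b c) + #(cn H c d) + #(cn H d e) + #(cn H e a)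
      + #(nn H h) + 2 * (#(nn H a) + #(nn H b) + #(nn H c) + #(nn H d) + #(nn H e)) := by
  rw [← card_univ]
  simp only [cn, nn, card_filter]
  simp only [← sum_add_distrib, mul_sum, card_eq_sum_ones]
  apply sum_le_sum
  intro x _
  have t1 : ¬ (H.Adj h x ∧ H.Adj a x ∧ H.Adj b x) := fun q => k4 hcf ha hb hab q.1 q.2.1 q.2.2
  have t2 : ¬ (H.Adj h x ∧ H.Adj b x ∧ H.Adj c x) := fun q => k4 hcf hb hc hbc q.1 q.2.1 q.2.2
  have t3 : ¬ (H.Adj h x ∧ H.Adj c x ∧ H.Adj d x) := fun q => k4 hcf hc hd hcd q.1 q.2.1 q.2.2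
  have t4 : ¬ (H.Adj h x ∧ H.Adj d x ∧ H.Adj e x) := fun q => k4 hcf hd he hde q.1 q.2.1 q.2.2
  have t5 : ¬ (H.Adj h x ∧ H.Adj e x ∧ H.Adj a x) := fun q => k4 hcf he ha hea q.1 q.2.1 q.2.2
  by_cases p0 : H.Adj h x <;> by_cases p1 : H.Adj a x <;> by_cases p2 : H.Adj b x <;>
    by_cases p3 : H.Adj c x <;> by_cases p4 : H.Adj d x <;> by_cases p5 : H.Adj e x <;>
    simp [p0, p1, p2, p3, p4, p5] at t1 t2 t3 t4 t5 ⊢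

theorem exK3 {G : SimpleGraph W} {n : ℕ} (hW : Fintype.card W = 5 * n)
    (hcf : G.CliqueFree 4) (hG : ∀ x, #(nn G x) + 1 ≤ 2 * n) :
    ∃ K : Finset W, (∀ a ∈ K, ∀ b ∈ K, ¬ G.Adj a b) ∧ 3 * n ≤ 2 * #K + 2 := by
  obtain ⟨H, hGH, hmax⟩ := Finite.exists_le_maximal (p := fun H : SimpleGraph W => H.CliqueFree 4) hcf
  have hHcf : H.CliqueFree 4 := hmax.prop
  have hH : ∀ x, #(nn H x) + 1 ≤ 2 * n := by
    intro x
    refine le_trans (Nat.succ_le_succ (card_le_card ?_)) (hG x)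
    intro v
    simp only [nn, mem_filter, mem_univ, true_and]
    exact fun h1 h2 => h1 (hGH h2)
  suffices hs : ∃ K : Finset W, (∀ a ∈ K, ∀ b ∈ K, ¬ H.Adj a b) ∧ 3 * n ≤ 2 * #K + 2 by
    obtain ⟨K, h1, h2⟩ := hs
    exact ⟨K, fun a ha b hb hab => h1 a ha b hb (hGH hab), h2⟩
  by_cases hmp : H.IsCompleteMultipartite
  · have hcol : H.Colorable 3 := hmp.colorable_of_cliqueFree hHcf
    obtain ⟨C⟩ := hcol
    have hsum : Fintype.card W = ∑ i : Fin 3, #(univ.filter (fun v => C v = i)) := by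
      rw [← card_univ]
      exact card_eq_sum_card_fiberwise (fun _ _ => by simp)
    have hex : ∃ i : Fin 3, 3 * n ≤ 2 * #(univ.filter (fun v => C v = i)) + 2 := by
      by_contra! hcon
      have h0 := hcon 0
      have h1 := hcon 1
      have h2 := hcon 2
      rw [Fin.sum_univ_three] at hsum
      omega
    obtain ⟨i, hi⟩ := hex
    refine ⟨_, ?_, hi⟩
    intro a ha b hb hab
    simp only [mem_filter, mem_univ, true_and] at ha hb
    exact C.valid hab (ha.trans hb.symm)
  · obtain ⟨k, v, w₁, w₂, s, t, hw, hk, hfree⟩ :=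
      SimpleGraph.exists_max_isFiveWheelLike_of_maximal_cliqueFree_not_isCompleteMultipartite
        (r := 2) hmax hmp
    have hk1 : k = 1 := by
      by_contra hne
      have hk0 : k = 0 := by omega
      subst hk0
      have h1 := hw.minDegree_le_of_cliqueFree_fiveWheelLikeFree_succ hHcf (hfree 1 (by omega))
      have h2 : 3 * n + 1 ≤ H.minDegree := by
        have : Nonempty W := ⟨v⟩
        apply H.le_minDegree_of_forall_le_degree
        intro x
        have e1 := card_filter_add_card_filter_not (s := (univ : Finset W)) (fun y => H.Adj x y)
        have e2 := hH x
        have e3 : H.degree x = #(univ.filter (fun y => H.Adj x y)) := by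
          rw [← SimpleGraph.card_neighborFinset_eq_degree, SimpleGraph.neighborFinset_eq_filter]
        rw [card_univ, hW] at e1
        unfold nn at e2
        omega
      rw [hW] at h1
      omega
    subst hk1
    obtain ⟨h, hh⟩ := card_eq_one.1 hw.card_inter
    have hhst : h ∈ s ∩ t := by rw [hh]; simp
    rw [mem_inter] at hhst
    obtain ⟨hhs, hht⟩ := hhst
    obtain ⟨a, ha⟩ := card_eq_one.1 (show #(s.erase h) = 1 by
      rw [card_erase_of_mem hhs, hw.card_left])
    obtain ⟨b, hb⟩ := card_eq_one.1 (show #(t.erase h) = 1 by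
      rw [card_erase_of_mem hht, hw.card_right])
    have ha' : a ∈ s.erase h := by rw [ha]; simp
    have hb' : b ∈ t.erase h := by rw [hb]; simp
    rw [mem_erase] at ha' hb'
    have adj : ∀ {x y : W} {q : Finset W} {N : ℕ}, H.IsNClique N (insert x q) → x ∉ q → y ∈ q →
        H.Adj x y := by
      intro x y q N hN hx hy
      exact hN.1 (by simp) (by simp [hy]) (fun h => hx (h ▸ hy))
    have hva := adj hw.isNClique_left hw.notMem_left ha'.2
    have hvh := adj hw.isNClique_left hw.notMem_left hhs
    have hvb := adj hw.isNClique_right hw.notMem_right hb'.2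
    have hw1a := adj hw.isNClique_fst_left hw.fst_notMem ha'.2
    have hw1h := adj hw.isNClique_fst_left hw.fst_notMem hhs
    have hw2b := adj hw.isNClique_snd_right hw.snd_notMem hb'.2
    have hw2h := adj hw.isNClique_snd_right hw.snd_notMem hht
    have hha : H.Adj h a := hw.isNClique_left.1 (by simp [hhs]) (by simp [ha'.2]) ha'.1.symm
    have hhb : H.Adj h b := hw.isNClique_right.1 (by simp [hht]) (by simp [hb'.2]) hb'.1.symm
    have hww : H.Adj w₁ w₂ := hw.isPathGraph3Compl.adj
    have hcount := wheel_count hHcf hvh.symm hha hw1h.symm hw2h.symm hhb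
      hva hw1a.symm hww hw2b hvb.symm
    rw [hW] at hcount
    have q0 := hH h
    have q1 := hH v
    have q2 := hH a
    have q3 := hH w₁
    have q4 := hH w₂
    have q5 := hH b
    by_contra! hcon
    have c1 := hcon _ (cn_indep hHcf hva)
    have c2 := hcon _ (cn_indep hHcf hw1a.symm)
    have c3 := hcon _ (cn_indep hHcf hww)
    have c4 := hcon _ (cn_indep hHcf hw2b)
    have c5 := hcon _ (cn_indep hHcf hvb.symm)
    omega

end K4

theorem Good.exK3' (h : Good G p n) (A : Finset ι) (hA : #A = 5) (hno : ¬ HasClique G p A 4) :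
    ∃ K : Finset V, (∀ k ∈ K, p k ∈ A) ∧ (∀ a ∈ K, ∀ b ∈ K, ¬ G.Adj a b) ∧
      3 * n ≤ 2 * #K + 2 := by
  let W := {v : V // p v ∈ A}
  let φ : W ↪ V := Function.Embedding.subtype _
  obtain ⟨K, hK, hKc⟩ := exK3 (W := W) (G := G.comap φ)
    (by rw [← hA, ← h.card_VA A, Fintype.card_subtype]; rfl)
    (by
      intro X hX
      apply hno
      refine ⟨X.map φ, ?_, ?_⟩
      · have := hX.map (f := φ)
        refine this.mono ?_
        exact SimpleGraph.map_comap_le _ _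
      · intro x hx
        obtain ⟨y, _, rfl⟩ := mem_map.1 hx
        exact y.2)
    (by
      intro x
      refine le_trans (Nat.succ_le_succ ?_) (h.nonadj (φ x) (VA p A))
      rw [← card_map φ]
      apply card_le_card
      intro v hv
      obtain ⟨y, hy, rfl⟩ := mem_map.1 hv
      simp only [nn, mem_filter, mem_univ, true_and, SimpleGraph.comap_adj] at hy
      exact mem_filter.2 ⟨mem_VA.2 y.2, hy⟩)
  refine ⟨K.map φ, ?_, ?_, by rwa [card_map]⟩
  · intro k hk
    obtain ⟨y, _, rfl⟩ := mem_map.1 hk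
    exact y.2
  · intro a ha b hb
    obtain ⟨y, hy, rfl⟩ := mem_map.1 ha
    obtain ⟨z, hz, rfl⟩ := mem_map.1 hb
    exact hK y hy z hz

theorem Good.main (h : Good G p n) (s : ℕ) (hs : 1 ≤ s) :
    ∀ A : Finset ι, #A = 2 * s + 1 → HasClique G p A (s + 2) := by
  induction s, hs using Nat.le_induction with
  | base => exact fun A hA => h.base A hA
  | succ s hs ih =>
    intro A hA
    by_contra hno
    have hP : ∀ A : Finset ι, #A = 2 * (s + 1) - 1 → HasClique G p A (s + 1 + 1) :=
      fun A hA => ih A (by omega)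
    have hex : ∃ K : Finset V, (∀ k ∈ K, p k ∈ A) ∧ (∀ a ∈ K, ∀ b ∈ K, ¬ G.Adj a b) ∧
        3 * n ≤ 2 * #K + 2 := by
      by_cases h2 : s = 1
      · subst h2
        exact h.exK3' A hA hno
      · exact h.exK (by omega) hP A hA hno
    obtain ⟨K, h1, h2, h3⟩ := hex
    exact hno (h.propA (by omega) hP A hA K h1 h2 h3)

/-- The `t`-colourable case. -/
theorem color_case [Fintype ι] {m t r : ℕ} (hn : 1 ≤ n) (hm : 2 ≤ m) (ht : 3 ≤ t)
    (hr : r + 1 = m * t) (hι : Fintype.card ι = r)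
    (hpart : ∀ v w, G.Adj v w → p v ≠ p w) (hfib : ∀ i, #(fib p i) = n)
    (hnn : ∀ v, #(nn G v) + 1 ≤ m * n) (C : G.Coloring (Fin t)) : False := by
  have hcard : Fintype.card V = r * n := by
    rw [← card_univ, card_eq_sum_card_fiberwise (f := p) (t := univ) (fun _ _ => by simp),
      ← hι, ← card_univ]
    apply sum_const_nat
    intro i _
    exact hfib i
  let cl : Fin t → Finset V := fun i => univ.filter (fun v => C v = i)
  have hmn : 1 ≤ m * n := Nat.mul_pos (by omega) hn
  have key : ∀ i, ∀ v ∈ cl i, #(cl i) + n + 1 ≤ m * n + #(cl i ∩ fib p (p v)) := by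
    intro i v hv
    have h1 : cl i ∪ fib p (p v) ⊆ nn G v := by
      intro w hw
      simp only [cl, mem_union, mem_filter, mem_univ, true_and, mem_fib] at hw hv
      simp only [nn, mem_filter, mem_univ, true_and]
      intro hadj
      rcases hw with hw | hw
      · exact C.valid hadj (hv.trans hw.symm)
      · exact hpart _ _ hadj hw.symm
    have h2 := card_le_card h1
    have h3 := card_union_add_card_inter (cl i) (fib p (p v))
    have h4 := hnn v
    rw [hfib] at h3
    omega
  have hle : ∀ i, #(cl i) + 1 ≤ m * n := by
    intro i
    rcases (cl i).eq_empty_or_nonempty with h | ⟨v, hv⟩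
    · rw [h]; simpa using hmn
    · have h1 := key i v hv
      have h2 : #(cl i ∩ fib p (p v)) ≤ n := by
        rw [← hfib (p v)]; exact card_le_card inter_subset_right
      omega
  let d : Fin t → ℕ := fun i => m * n - #(cl i)
  have hd : ∀ i, #(cl i) + d i = m * n := by
    intro i; have := hle i; simp only [d]; omega
  have hd1 : ∀ i, 1 ≤ d i := by
    intro i; have := hle i; simp only [d]; omega
  have hsum : ∑ i, #(cl i) = r * n := by
    rw [← hcard, ← card_univ]
    exact (card_eq_sum_card_fiberwise (fun _ _ => by simp)).symm
  have hdsum : ∑ i, d i = n := by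
    have h1 : ∑ i, (#(cl i) + d i) = t * (m * n) := by
      rw [sum_congr rfl (fun i _ => hd i)]; simp
    rw [sum_add_distrib, hsum] at h1
    have h2 : t * (m * n) = r * n + n := by
      rw [← mul_assoc, mul_comm t m, ← hr]; ring
    omega
  have hd2 : ∀ i j, i ≠ j → d i + d j ≤ n := by
    intro i j hij
    rw [← sum_pair hij, ← hdsum]
    exact sum_le_sum_of_subset (subset_univ _)
  have hdlt : ∀ i, d i < n := by
    intro i
    have : Nontrivial (Fin t) := Fin.nontrivial_iff_two_le.2 (by omega)
    obtain ⟨j, hj⟩ := exists_ne i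
    have h1 := hd2 j i hj
    have h2 := hd1 j
    omega
  have hparts : ∀ i, m ≤ #((cl i).image p) := by
    intro i
    by_contra! hcon
    have h1 : #(cl i) ≤ #((cl i).image p) * n := by
      rw [card_eq_sum_card_image p (cl i), ← smul_eq_mul]
      apply sum_le_card_nsmul
      intro l _
      rw [← hfib l]
      apply card_le_card
      intro v hv
      exact mem_fib.2 (mem_filter.1 hv).2
    have h2 : (#((cl i).image p) + 1) * n ≤ m * n := Nat.mul_le_mul_right n hcon
    have h3 := hd i
    have h4 := hdlt i
    rw [add_mul, one_mul] at h2
    omega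
  have hnd : ∃ i j, i ≠ j ∧ ¬ Disjoint ((cl i).image p) ((cl j).image p) := by
    by_contra! hcon
    have h1 : #(univ.biUnion (fun i => (cl i).image p)) = ∑ i, #((cl i).image p) :=
      card_biUnion (fun i _ j _ hij => hcon i j hij)
    have h2 : #(univ.biUnion (fun i => (cl i).image p)) ≤ r := by
      rw [← hι]; exact card_le_univ _
    have h3 : t * m ≤ ∑ i, #((cl i).image p) := by
      have := card_nsmul_le_sum (univ : Finset (Fin t)) (fun i => #((cl i).image p)) m
        (fun i _ => hparts i)
      simpa using this
    rw [mul_comm] at h3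
    omega
  obtain ⟨i, j, hij, hnd⟩ := hnd
  rw [not_disjoint_iff] at hnd
  obtain ⟨l, hli, hlj⟩ := hnd
  obtain ⟨v, hv, hvl⟩ := mem_image.1 hli
  obtain ⟨w, hw, hwl⟩ := mem_image.1 hlj
  have k1 := key i v hv
  have k2 := key j w hw
  rw [hvl] at k1
  rw [hwl] at k2
  have k3 : #(cl i ∩ fib p l) + #(cl j ∩ fib p l) ≤ n := by
    rw [← card_union_of_disjoint, ← hfib l]
    · exact card_le_card (union_subset inter_subset_right inter_subset_right)
    · rw [disjoint_left]
      intro x hx hx'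
      have a := (mem_filter.1 (mem_inter.1 hx).1).2
      have b := (mem_filter.1 (mem_inter.1 hx').1).2
      exact hij (a.symm.trans b)
  have k4 := hd i
  have k5 := hd j
  have k6 := hd2 i j hij
  omega

lemma degree_add_nn {W : Type*} [Fintype W] (G : SimpleGraph W) (x : W) :
    G.degree x + #(nn G x) = Fintype.card W := by
  have e1 := card_filter_add_card_filter_not (s := (univ : Finset W)) (fun y => G.Adj x y)
  rw [← SimpleGraph.card_neighborFinset_eq_degree, SimpleGraph.neighborFinset_eq_filter]
  exact e1

theorem upper {n m t r : ℕ} (hn : 1 ≤ n) (hm : 2 ≤ m) (ht : 3 ≤ t) (hr : r + 1 = m * t)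
    (hAES : ∀ G : SimpleGraph (Fin r × Fin n), G.CliqueFree (t + 1) →
      ((3 * t - 4 : ℚ) / (3 * t - 1)) * (r * n) < G.minDegree →
      G.chromaticNumber ≤ (t : ℕ∞)) (G : SimpleGraph (Fin r × Fin n))
    (hG : IsPartite G) (hcf : G.CliqueFree (t + 1)) : G.minDegree ≤ (r - m) * n := by
  by_contra! hcon
  have hmr : m ≤ r := by nlinarith
  have hrn : (r - m) * n + m * n = r * n := by
    rw [← add_mul, Nat.sub_add_cancel hmr]
  have hnn : ∀ v, #(nn G v) + 1 ≤ m * n := by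
    intro v
    have h1 := degree_add_nn G v
    have h2 := G.minDegree_le_degree v
    simp only [Fintype.card_prod, Fintype.card_fin] at h1
    omega
  have hfib : ∀ i : Fin r, #(fib (Prod.fst : Fin r × Fin n → Fin r) i) = n := by
    intro i
    have : fib (Prod.fst : Fin r × Fin n → Fin r) i = {i} ×ˢ univ := by
      ext ⟨a, b⟩
      simp [fib, eq_comm]
    rw [this, card_product]
    simp
  by_cases hm2 : m = 2
  · subst hm2
    have hg : Good G Prod.fst n := by
      refine ⟨hn, hG, hfib, ?_⟩
      intro v
      have h1 : M G Prod.fst v ∪ fib Prod.fst v.1 ⊆ nn G v := by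
        intro w hw
        simp only [nn, mem_filter, mem_univ, true_and]
        rcases mem_union.1 hw with hw | hw
        · exact (mem_M.1 hw).2
        · intro hadj
          exact hG _ _ hadj (mem_fib.1 hw).symm
      have h2 := card_le_card h1
      rw [card_union_of_disjoint, hfib] at h2
      · have := hnn v
        omega
      · rw [disjoint_left]
        intro w hw hw'
        exact (mem_M.1 hw).1 (mem_fib.1 hw')
    obtain ⟨X, hX, -⟩ := hg.main (t - 1) (by omega) univ (by
      rw [card_univ, Fintype.card_fin]; omega)
    rw [show t - 1 + 2 = t + 1 by omega] at hX
    exact hcf X hX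
  · have hm3 : 3 ≤ m := by omega
    have hchi := hAES G hcf (by
      have h1 : (((r - m) * n + 1 : ℕ) : ℚ) ≤ G.minDegree := by exact_mod_cast hcon
      refine lt_of_lt_of_le ?_ h1
      push_cast [hmr]
      have hr' : (r : ℚ) = m * t - 1 := by
        have : ((r + 1 : ℕ) : ℚ) = ((m * t : ℕ) : ℚ) := by rw [hr]
        push_cast at this
        linarith
      have ht' : (3 : ℚ) ≤ t := by exact_mod_cast ht
      have hm' : (3 : ℚ) ≤ m := by exact_mod_cast hm3
      have hn' : (1 : ℚ) ≤ n := by exact_mod_cast hn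
      have hpos : (0 : ℚ) < 3 * t - 1 := by linarith
      rw [div_mul_eq_mul_div, div_lt_iff₀ hpos, hr']
      nlinarith [mul_nonneg (sub_nonneg.2 hm') (zero_le_one.trans hn')])
    have hcol : G.Colorable t := SimpleGraph.chromaticNumber_le_iff_colorable.1 hchi
    obtain ⟨C⟩ := hcol
    exact color_case hn hm ht hr (by simp) hG hfib hnn C

theorem lower {n m t r : ℕ} (hn : 1 ≤ n) (hm : 2 ≤ m) (ht : 3 ≤ t) (hr : r + 1 = m * t) :
    ∃ G : SimpleGraph (Fin r × Fin n), IsPartite G ∧ G.CliqueFree (t + 1) ∧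
      (r - m) * n ≤ G.minDegree := by
  have hmr : m ≤ r := by nlinarith
  have hrn : (r - m) * n + m * n = r * n := by
    rw [← add_mul, Nat.sub_add_cancel hmr]
  obtain ⟨G, hadj⟩ : ∃ G : SimpleGraph (Fin r × Fin n),
      ∀ v w, G.Adj v w ↔ v.1.1 / m ≠ w.1.1 / m :=
    ⟨{ Adj := fun v w => v.1.1 / m ≠ w.1.1 / m
       symm := ⟨fun v w h => Ne.symm h⟩
       loopless := ⟨fun v h => h rfl⟩ }, fun _ _ => Iff.rfl⟩
  refine ⟨G, ?_, ?_, ?_⟩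
  · intro v w h hvw
    exact (hadj v w).1 h (by rw [hvw])
  · have hcol : G.Colorable t := by
      refine ⟨SimpleGraph.Coloring.mk (fun v => ⟨v.1.1 / m, ?_⟩) ?_⟩
      · rw [Nat.div_lt_iff_lt_mul (by omega), mul_comm]
        have := v.1.2
        omega
      · intro v w h heq
        exact (hadj v w).1 h (by simpa using heq)
    exact hcol.cliqueFree (Nat.lt_succ_self t)
  · have : Nonempty (Fin r × Fin n) := ⟨⟨⟨0, by omega⟩, ⟨0, by omega⟩⟩⟩
    apply G.le_minDegree_of_forall_le_degree
    intro v
    have h1 := degree_add_nn G v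
    simp only [Fintype.card_prod, Fintype.card_fin] at h1
    have h2 : #(nn G v) ≤ m * n := by
      have h3 : #(nn G v) ≤ #(range m ×ˢ (univ : Finset (Fin n))) := by
        apply card_le_card_of_injOn (fun w => (w.1.1 % m, w.2))
        · intro w _
          simp [Nat.mod_lt _ (show 0 < m by omega)]
        · intro a ha b hb hab
          simp only [nn, coe_filter, mem_univ, true_and, Set.mem_setOf_eq, hadj, not_not] at ha hb
          simp only [Prod.mk.injEq] at hab
          refine Prod.ext (Fin.ext ?_) hab.2
          rw [← Nat.div_add_mod a.1.1 m, ← Nat.div_add_mod b.1.1 m, hab.1, ← ha, ← hb]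
      simpa using h3
    omega

end MPart

/-- Theorem 1.2: for `n ≥ 1`, `m ≥ 2`, `t ≥ 3` and `r = mt - 1`,
`f(n,r,t+1) = (r - ⌈r/t⌉)n = (r - m)n` (assuming the Andrásfai–Erdős–Sós theorem). -/
theorem stmt15 (n m t r : ℕ) (hn : 1 ≤ n) (hm : 2 ≤ m) (ht : 3 ≤ t) (hr : r = m * t - 1)
    (hAES : ∀ G : SimpleGraph (Fin r × Fin n), G.CliqueFree (t + 1) →
      ((3 * t - 4 : ℚ) / (3 * t - 1)) * (r * n) < G.minDegree →
      G.chromaticNumber ≤ (t : ℕ∞)) :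
    f n r (t + 1) = (r - r ⌈/⌉ t) * n ∧ f n r (t + 1) = (r - m) * n := by
  have hr1 : r + 1 = m * t := by
    have : 1 ≤ m * t := Nat.mul_pos (by omega) (by omega)
    omega
  have hceil : r ⌈/⌉ t = m := by
    rw [Nat.ceilDiv_eq_add_pred_div]
    have : r + t - 1 = (t - 2) + m * t := by omega
    rw [this, Nat.add_mul_div_right _ _ (by omega), Nat.div_eq_of_lt (by omega), zero_add]
  have hmain : f n r (t + 1) = (r - m) * n := by
    apply IsGreatest.csSup_eq
    constructor
    · obtain ⟨G, h1, h2, h3⟩ := MPart.lower hn hm ht hr1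
      exact ⟨G, h1, h2, le_antisymm (MPart.upper hn hm ht hr1 hAES G h1 h2) h3⟩
    · rintro d ⟨G, h1, h2, rfl⟩
      exact MPart.upper hn hm ht hr1 hAES G h1 h2
  rw [hceil]
  exact ⟨hmain, hmain⟩
end
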